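/- Fix d ∈ ℕ and c ≥ 1. There exists a constant C, depending only on d and c, such that for every τ > 0 the following hold: (1) for every classical atom a on ℝ^d (i.e. a is supported in a cube K ⊆ ℝ^d, ‖a‖_∞ ≤ |K|⁻¹ and ∫ a = 0), ∫_{ℝ^d} sup_{0<t≤τ²} |∫_{ℝ^d} H_t(x,y) a(y) dy| dx ≤ C; and (2) for every cuboid Q = Q(z,r₁,…,r_d) ⊆ ℝ^d with τ/c ≤ r_i ≤ cτ for all i, the function a = |Q|⁻¹ χ_Q satisfies ∫_{ℝ^d} sup_{0<t≤τ²} |∫_{ℝ^d} H_t(x,y) a(y) dy| dx ≤ C. -/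

import Mathlib

open MeasureTheory Set Metric Filter
open scoped ENNReal NNReal

noncomputable section

/-- `ℝ^d` with the Euclidean structure and the Lebesgue measure. -/
abbrev Rd (d : ℕ) := EuclideanSpace ℝ (Fin d)

/-- The cuboid `Q(z, r₁, …, r_d)`, always taken as a subset of `X`. -/
def cuboid {d : ℕ} (X : Set (Rd d)) (z : Rd d) (r : Fin d → ℝ) : Set (Rd d) :=
  {x ∈ X | ∀ i, |x i - z i| ≤ r i}

/-- The `k`-fold enlargement `Q^{*⋯*}` of the cuboid, with enlargement parameter `κ`
(`k = 1` is `Q^*`, `k = 2` is `Q^{**}`, `k = 3` is `Q^{***}`). -/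
def cuboidSt {d : ℕ} (X : Set (Rd d)) (z : Rd d) (r : Fin d → ℝ) (κ : ℝ) (k : ℕ) :
    Set (Rd d) :=
  cuboid X z fun i => κ ^ k * r i

/-- The classical heat kernel `H_t(x,y) = (4πt)^{-d/2} exp(-|x-y|²/(4t))` on `ℝ^d`. -/
def heatK (d : ℕ) (t : ℝ) (x y : Rd d) : ℝ :=
  (4 * Real.pi * t) ^ (-(d : ℝ) / 2) * Real.exp (-dist x y ^ 2 / (4 * t))

/-- An upper bound for `v ^ n * exp (-v² / 16)` over real `v`. -/
def gaussMomentBound (n : ℕ) : ℝ := 1 + 16 ^ n * (n.factorial : ℝ)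

lemma gaussMomentBound_pos (n : ℕ) : 0 < gaussMomentBound n := by
  unfold gaussMomentBound; positivity

lemma pow_mul_exp_neg_sq_le (n : ℕ) (v : ℝ) :
    v ^ n * Real.exp (-v ^ 2 / 16) ≤ gaussMomentBound n := by
  set y := v ^ 2 / 16 with hy
  have hy0 : 0 ≤ y := by positivity
  have hfac : (0 : ℝ) < n.factorial := by positivity
  have hpow : y ^ n ≤ n.factorial * Real.exp y := by
    have := Real.pow_div_factorial_le_exp y hy0 n
    rwa [div_le_iff₀ hfac, mul_comm] at this
  have hvn : v ^ n ≤ 1 + 16 ^ n * y ^ n := by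
    have : (16 : ℝ) ^ n * y ^ n = (v ^ n) ^ 2 := by
      rw [← mul_pow, hy, ← pow_mul, mul_comm n 2, pow_mul]; congr 1; ring
    rw [this]; nlinarith [sq_nonneg (v ^ n - 1)]
  have hexp : 1 ≤ Real.exp y := Real.one_le_exp hy0
  rw [show -v ^ 2 / 16 = -y by rw [hy]; ring, Real.exp_neg, ← div_eq_mul_inv,
    div_le_iff₀ (Real.exp_pos y)]
  unfold gaussMomentBound
  calc v ^ n ≤ 1 + 16 ^ n * y ^ n := hvn
    _ ≤ Real.exp y + 16 ^ n * (n.factorial * Real.exp y) := by gcongr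
    _ = _ := by ring

lemma exp_neg_sq_div_le (n : ℕ) {q s : ℝ} (hq : 0 < q) (hs : 0 < s) :
    Real.exp (-q ^ 2 / (16 * s ^ 2)) ≤ gaussMomentBound n * s ^ n / q ^ n := by
  have h := pow_mul_exp_neg_sq_le n (q / s)
  rw [show -(q / s) ^ 2 / 16 = -q ^ 2 / (16 * s ^ 2) by field_simp, div_pow] at h
  rw [le_div_iff₀ (by positivity)]
  rw [div_mul_eq_mul_div, div_le_iff₀ (by positivity)] at h
  linarith

lemma heatK_pos (d : ℕ) {t : ℝ} (ht : 0 < t) (x y : Rd d) : 0 < heatK d t x y := by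
  unfold heatK; positivity

lemma continuous_heatK (d : ℕ) (t : ℝ) (x : Rd d) : Continuous (heatK d t x) := by
  unfold heatK; fun_prop

lemma heatK_eq_const_mul_exp (d : ℕ) (t : ℝ) (x y : Rd d) :
    heatK d t x y = (4 * Real.pi * t) ^ (-(d : ℝ) / 2) *
      Real.exp (-(1 / (4 * t)) * ‖y - x‖ ^ 2) := by
  unfold heatK
  rw [dist_comm, dist_eq_norm]; congr 2; ring

lemma integral_heatK (d : ℕ) {t : ℝ} (ht : 0 < t) (x : Rd d) :
    ∫ y, heatK d t x y = 1 := by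
  simp_rw [heatK_eq_const_mul_exp]
  rw [integral_const_mul,
    integral_sub_right_eq_self (fun y : Rd d => Real.exp (-(1 / (4 * t)) * ‖y‖ ^ 2)) x,
    GaussianFourier.integral_rexp_neg_mul_sq_norm (by positivity)]
  rw [finrank_euclideanSpace_fin, show Real.pi / (1 / (4 * t)) = 4 * Real.pi * t by
    field_simp, ← Real.rpow_add (by positivity)]
  simp [neg_div]

lemma integrable_heatK (d : ℕ) {t : ℝ} (ht : 0 < t) (x : Rd d) :
    Integrable (heatK d t x) :=
  .of_integral_ne_zero (by rw [integral_heatK d ht x]; exact one_ne_zero)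

lemma heatK_prefactor_le (d : ℕ) {s : ℝ} (hs : 0 < s) :
    (4 * Real.pi * s ^ 2) ^ (-(d : ℝ) / 2) ≤ 1 / s ^ d := by
  have h1 : s ^ 2 ≤ 4 * Real.pi * s ^ 2 := by
    nlinarith [Real.pi_gt_three, sq_nonneg s]
  have hd : -(d : ℝ) / 2 ≤ 0 := by
    have : (0 : ℝ) ≤ d := by positivity
    linarith
  refine (Real.rpow_le_rpow_of_nonpos (by positivity) h1 hd).trans_eq ?_
  rw [← Real.rpow_natCast s 2, ← Real.rpow_mul hs.le, ← Real.rpow_natCast s d, one_div,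
    ← Real.rpow_neg hs.le]
  congr 1; push_cast; ring

lemma half_dist_le {d : ℕ} {x y w : Rd d} {R : ℝ} (hy : dist y w ≤ R)
    (hx : 2 * R ≤ dist x w) : dist x w / 2 ≤ dist x y := by
  linarith [dist_triangle x y w]

lemma exp_neg_sq_le_of_half_le {p q s : ℝ} (hs : 0 < s) (hq : 0 ≤ q) (hpq : q / 2 ≤ p) :
    Real.exp (-p ^ 2 / (4 * s ^ 2)) ≤ Real.exp (-q ^ 2 / (16 * s ^ 2)) := by
  apply Real.exp_le_exp.2
  rw [show -q ^ 2 / (16 * s ^ 2) = -(q / 2) ^ 2 / (4 * s ^ 2) by field_simp; ring]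
  gcongr

/-- Off-diagonal size estimate for the heat kernel at time `s²`. -/
lemma heatK_le_of_far (d : ℕ) {s R : ℝ} (hs : 0 < s) (hR : 0 < R) {x y w : Rd d}
    (hy : dist y w ≤ R) (hx : 2 * R ≤ dist x w) :
    heatK d (s ^ 2) x y ≤ gaussMomentBound (d + 1) * s / dist x w ^ (d + 1) := by
  have hq : 0 < dist x w := by linarith
  have h := (exp_neg_sq_le_of_half_le hs hq.le (half_dist_le hy hx)).trans
    (exp_neg_sq_div_le (d + 1) hq hs)
  unfold heatK
  calc _ ≤ 1 / s ^ d * (gaussMomentBound (d + 1) * s ^ (d + 1) / dist x w ^ (d + 1)) := by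
        gcongr
        exact heatK_prefactor_le d hs
    _ = _ := by field_simp; ring

lemma abs_exp_neg_sub_exp_neg_le {a b m : ℝ} (ha : m ≤ a) (hb : m ≤ b) :
    |Real.exp (-a) - Real.exp (-b)| ≤ Real.exp (-m) * |a - b| := by
  wlog hab : a ≤ b generalizing a b
  · rw [abs_sub_comm, abs_sub_comm a b]
    exact this hb ha (le_of_not_ge hab)
  have h1 : Real.exp (-b) ≤ Real.exp (-a) := Real.exp_le_exp.2 (by linarith)
  rw [abs_of_nonneg (by linarith), abs_of_nonpos (by linarith)]
  have h2 : Real.exp (-b) = Real.exp (-a) * Real.exp (a - b) := by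
    rw [← Real.exp_add]; congr 1; ring
  have h3 := Real.add_one_le_exp (a - b)
  have h4 : Real.exp (-a) ≤ Real.exp (-m) := Real.exp_le_exp.2 (by linarith)
  have h5 := Real.exp_pos (-a)
  calc Real.exp (-a) - Real.exp (-b) = Real.exp (-a) * (1 - Real.exp (a - b)) := by
        rw [h2]; ring
    _ ≤ Real.exp (-a) * (-(a - b)) := by gcongr; linarith
    _ ≤ _ := by gcongr; linarith

/-- Off-diagonal smoothness estimate for the heat kernel at time `s²`. -/
lemma abs_heatK_sub_heatK_le_of_far (d : ℕ) {s R : ℝ} (hs : 0 < s) (hR : 0 < R) {x y w : Rd d}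
    (hy : dist y w ≤ R) (hx : 2 * R ≤ dist x w) :
    |heatK d (s ^ 2) x y - heatK d (s ^ 2) x w| ≤
      gaussMomentBound (d + 2) * R / dist x w ^ (d + 1) := by
  set q := dist x w with hqdef
  set p := dist x y with hpdef
  have hq : 0 < q := by linarith
  have hp : q / 2 ≤ p := half_dist_le hy hx
  have hpq1 : p ≤ q + R := by
    have := dist_triangle x w y
    rw [dist_comm w y] at this
    linarith
  have hpq2 : q ≤ p + R := by linarith [dist_triangle x y w]
  have hdiff : |p ^ 2 / (4 * s ^ 2) - q ^ 2 / (4 * s ^ 2)| ≤ R * q / s ^ 2 := by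
    rw [← sub_div, abs_div, abs_of_pos (show (0 : ℝ) < 4 * s ^ 2 by positivity),
      div_le_div_iff₀ (by positivity) (by positivity)]
    have : |p ^ 2 - q ^ 2| ≤ R * q * 4 := by
      rw [abs_le]; constructor <;> nlinarith
    nlinarith [sq_nonneg s]
  have hm (u : ℝ) (hu : q / 2 ≤ u) : q ^ 2 / (16 * s ^ 2) ≤ u ^ 2 / (4 * s ^ 2) := by
    rw [show q ^ 2 / (16 * s ^ 2) = (q / 2) ^ 2 / (4 * s ^ 2) by field_simp; ring]
    gcongr
  have hexp := abs_exp_neg_sub_exp_neg_le (hm p hp) (hm q (by linarith))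
  have hmom := exp_neg_sq_div_le (d + 2) hq hs
  unfold heatK
  rw [← mul_sub, abs_mul, abs_of_nonneg (by positivity), ← hqdef, ← hpdef]
  rw [neg_div] at hmom
  rw [neg_div _ (p ^ 2), neg_div _ (q ^ 2)]
  calc _ ≤ 1 / s ^ d * (gaussMomentBound (d + 2) * s ^ (d + 2) / q ^ (d + 2) *
          (R * q / s ^ 2)) := by
        refine mul_le_mul (heatK_prefactor_le d hs) (hexp.trans ?_) (abs_nonneg _)
          (by positivity)
        refine mul_le_mul hmom hdiff (abs_nonneg _) ?_
        exact (Real.exp_pos _).le.trans hmom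
    _ = _ := by field_simp; ring

/-- A function bounded by `K / R ^ d` everywhere and by `K * R / |x - w| ^ (d + 1)` outside the
ball of radius `2 * R` about `w` has integral bounded in terms of `d` and `K` only. -/
lemma lintegral_le_of_near_far (d : ℕ) {K R : ℝ} (hK : 0 ≤ K) (hR : 0 < R) (w : Rd d)
    (F : Rd d → ℝ≥0∞) (near : ∀ x, F x ≤ ENNReal.ofReal (K / R ^ d))
    (far : ∀ x, 2 * R ≤ dist x w → F x ≤ ENNReal.ofReal (K * R / dist x w ^ (d + 1))) :
    ∫⁻ x, F x ≤ ENNReal.ofReal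
      (K * 3 ^ (d + 1) * ∫ x : Rd d, (1 + ‖x‖) ^ (-((d + 1 : ℕ) : ℝ))) := by
  set φ : Rd d → ℝ := fun x => (1 + ‖x‖) ^ (-((d + 1 : ℕ) : ℝ)) with hφ
  have hφ' (x : Rd d) : φ x = ((1 + ‖x‖) ^ (d + 1))⁻¹ := by
    simp only [hφ]
    rw [Real.rpow_neg (by positivity), Real.rpow_natCast]
  have hint : Integrable φ :=
    integrable_one_add_norm (by rw [finrank_euclideanSpace_fin]; push_cast; linarith)
  have hscaled : Integrable fun x : Rd d => K * 3 ^ (d + 1) / R ^ d * φ (R⁻¹ • (x - w)) :=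
    ((hint.comp_smul (inv_ne_zero hR.ne')).comp_sub_right w).const_mul _
  have hpt (x : Rd d) :
      F x ≤ ENNReal.ofReal (K * 3 ^ (d + 1) / R ^ d * φ (R⁻¹ • (x - w))) := by
    rw [hφ', norm_smul, ← dist_eq_norm, Real.norm_of_nonneg (by positivity)]
    rcases le_total (2 * R) (dist x w) with hx | hx
    · refine (far x hx).trans (ENNReal.ofReal_le_ofReal ?_)
      set q := dist x w
      have hq : 0 < q := by linarith
      have hle : (1 + R⁻¹ * q) ^ (d + 1) ≤ 3 ^ (d + 1) * (q / R) ^ (d + 1) := by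
        rw [← mul_pow]
        gcongr
        have : 2 ≤ q / R := by rwa [le_div_iff₀ hR]
        rw [inv_mul_eq_div]; linarith
      calc K * R / q ^ (d + 1)
          = K * 3 ^ (d + 1) / R ^ d * (3 ^ (d + 1) * (q / R) ^ (d + 1))⁻¹ := by
            rw [div_pow]; field_simp; ring
        _ ≤ _ := by gcongr
    · refine (near x).trans (ENNReal.ofReal_le_ofReal ?_)
      set q := dist x w
      have hq : 0 ≤ q := dist_nonneg
      have hle : (1 + R⁻¹ * q) ^ (d + 1) ≤ 3 ^ (d + 1) := by
        gcongr
        have : q / R ≤ 2 := by rwa [div_le_iff₀ hR]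
        rw [inv_mul_eq_div]; linarith
      calc K / R ^ d = K * 3 ^ (d + 1) / R ^ d * (3 ^ (d + 1))⁻¹ := by field_simp
        _ ≤ _ := by gcongr
  refine (lintegral_mono hpt).trans_eq ?_
  rw [← ofReal_integral_eq_lintegral_ofReal hscaled]
  · congr 1
    rw [integral_const_mul, integral_sub_right_eq_self (fun x : Rd d => φ (R⁻¹ • x)) w,
      Measure.integral_comp_inv_smul, finrank_euclideanSpace_fin, abs_of_pos (by positivity),
      smul_eq_mul]
    field_simp
  · exact ae_of_all _ fun x => by simp only [hφ', Pi.zero_apply]; positivity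

lemma cuboid_univ_eq_preimage {d : ℕ} (z : Rd d) (r : Fin d → ℝ) :
    cuboid univ z r = (MeasurableEquiv.toLp 2 (Fin d → ℝ)).symm ⁻¹'
      Icc (fun i => z i - r i) (fun i => z i + r i) := by
  ext x
  simp only [cuboid, mem_univ, true_and, mem_ofPred_eq, mem_preimage, mem_Icc, Pi.le_def,
    abs_le, ← forall_and]
  refine forall_congr' fun i => ?_
  change _ ↔ z i - r i ≤ x i ∧ x i ≤ z i + r i
  constructor <;> rintro ⟨h1, h2⟩ <;> constructor <;> linarith

lemma measurableSet_cuboid_univ {d : ℕ} (z : Rd d) (r : Fin d → ℝ) :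
    MeasurableSet (cuboid univ z r) := by
  rw [cuboid_univ_eq_preimage]
  exact (MeasurableEquiv.measurable _) measurableSet_Icc

lemma toReal_volume_cuboid_univ {d : ℕ} (z : Rd d) {r : Fin d → ℝ} (hr : ∀ i, 0 ≤ r i) :
    (volume (cuboid univ z r)).toReal = ∏ i, 2 * r i := by
  rw [cuboid_univ_eq_preimage,
    (EuclideanSpace.volume_preserving_symm_measurableEquiv_toLp (Fin d)).measure_preimage
      measurableSet_Icc.nullMeasurableSet,
    Real.volume_Icc_pi_toReal (fun i => by linarith [hr i])]
  exact Finset.prod_congr rfl fun i _ => by ring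

lemma dist_le_of_mem_cuboid {d : ℕ} {z y : Rd d} {r : Fin d → ℝ} {b : ℝ} (hb : 0 ≤ b)
    (hr : ∀ i, r i ≤ b) (hy : y ∈ cuboid univ z r) : dist y z ≤ (d + 1) * b := by
  rw [EuclideanSpace.dist_eq]
  apply Real.sqrt_le_iff.2 ⟨by positivity, ?_⟩
  calc ∑ i, dist (y i) (z i) ^ 2 ≤ ∑ _i : Fin d, b ^ 2 := by
        refine Finset.sum_le_sum fun i _ => ?_
        rw [Real.dist_eq]
        gcongr
        exact (hy.2 i).trans (hr i)
    _ = d * b ^ 2 := by simp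
    _ ≤ ((d + 1) * b) ^ 2 := by
        have : (0 : ℝ) ≤ d := by positivity
        nlinarith [sq_nonneg b, mul_nonneg this (sq_nonneg b),
          mul_nonneg (mul_nonneg this this) (sq_nonneg b)]

lemma inv_toReal_volume_cuboid_le {d : ℕ} (z : Rd d) {r : Fin d → ℝ} {l : ℝ} (hl : 0 < l)
    (hr : ∀ i, l ≤ r i) : ((volume (cuboid univ z r)).toReal)⁻¹ ≤ 1 / l ^ d := by
  rw [toReal_volume_cuboid_univ z fun i => hl.le.trans (hr i), one_div]
  gcongr
  calc l ^ d = ∏ _i : Fin d, l := by simp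
    _ ≤ _ := Finset.prod_le_prod (fun _ _ => hl.le) fun i _ => by linarith [hr i]

lemma integrable_indicator_cuboid {d : ℕ} (z : Rd d) (r : Fin d → ℝ) (b : ℝ) :
    Integrable ((cuboid univ z r).indicator fun _ => b) := by
  refine (integrable_indicator_iff (measurableSet_cuboid_univ z r)).2 (integrableOn_const ?_)
  rw [cuboid_univ_eq_preimage,
    (EuclideanSpace.volume_preserving_symm_measurableEquiv_toLp (Fin d)).measure_preimage
      measurableSet_Icc.nullMeasurableSet]
  exact isCompact_Icc.measure_lt_top.ne

lemma norm_integral_smul_le_of_norm_le {d : ℕ} {z : Rd d} {r : Fin d → ℝ} {a : Rd d → ℂ}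
    (hr : ∀ i, 0 < r i)
    (ha : ∀ y, ‖a y‖ ≤
      (cuboid univ z r).indicator (fun _ => ((volume (cuboid univ z r)).toReal)⁻¹) y)
    {k : Rd d → ℝ} {M : ℝ} (hk : ∀ y ∈ cuboid univ z r, |k y| ≤ M) :
    ‖∫ y, k y • a y‖ ≤ M := by
  set Q := cuboid univ z r
  have hvol : 0 < (volume Q).toReal := by
    rw [toReal_volume_cuboid_univ z fun i => (hr i).le]
    exact Finset.prod_pos fun i _ => by linarith [hr i]
  have hQ : MeasurableSet Q := measurableSet_cuboid_univ z r
  have hg := integrable_indicator_cuboid z r (volume Q).toReal⁻¹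
  have hbound (y : Rd d) : ‖k y • a y‖ ≤ M * Q.indicator (fun _ => (volume Q).toReal⁻¹) y := by
    rw [norm_smul, Real.norm_eq_abs]
    by_cases hy : y ∈ Q
    · exact mul_le_mul (hk y hy) (ha y) (norm_nonneg _) ((abs_nonneg _).trans (hk y hy))
    · have := ha y
      rw [indicator_of_notMem hy] at this ⊢
      rw [le_antisymm this (norm_nonneg _)]; simp
  refine (norm_integral_le_of_norm_le (hg.const_mul M) (ae_of_all _ hbound)).trans_eq ?_
  rw [integral_const_mul, integral_indicator hQ, setIntegral_const, smul_eq_mul,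
    measureReal_def, mul_inv_cancel₀ hvol.ne', mul_one]

lemma norm_integral_heatK_smul_le {d : ℕ} {t A : ℝ} (ht : 0 < t) (x : Rd d) {a : Rd d → ℂ}
    (ha : ∀ y, ‖a y‖ ≤ A) : ‖∫ y, heatK d t x y • a y‖ ≤ A := by
  refine (norm_integral_le_of_norm_le ((integrable_heatK d ht x).mul_const A)
    (ae_of_all _ fun y => ?_)).trans_eq ?_
  · rw [norm_smul, Real.norm_of_nonneg (heatK_pos d ht x y).le]
    exact mul_le_mul_of_nonneg_left (ha y) (heatK_pos d ht x y).le
  · rw [integral_mul_const, integral_heatK d ht x, one_mul]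

/-- Subtracting a constant from the kernel does not increase the integral against a function of
mean zero; the inequality also covers functions that are not integrable. -/
lemma norm_integral_heatK_smul_le_of_integral_eq_zero {d : ℕ} {t A : ℝ} (ht : 0 < t) (x : Rd d)
    {a : Rd d → ℂ} (ha : ∀ y, ‖a y‖ ≤ A) (h0 : ∫ y, a y = 0)
    (hint : AEStronglyMeasurable a → Integrable a) (b : ℝ) :
    ‖∫ y, heatK d t x y • a y‖ ≤ ‖∫ y, (heatK d t x y - b) • a y‖ := by
  by_cases hm : AEStronglyMeasurable a
  · have h1 : Integrable fun y => heatK d t x y • a y :=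
      (integrable_heatK d ht x).smul_bdd A hm (ae_of_all _ ha)
    simp_rw [sub_smul]
    rw [integral_sub h1 (g := fun y => b • a y) ((hint hm).smul b), integral_smul, h0, smul_zero, sub_zero]
  · rw [integral_undef, norm_zero]
    · exact norm_nonneg _
    · intro h
      apply hm
      have h2 : AEStronglyMeasurable (fun y => (heatK d t x y)⁻¹ • (heatK d t x y • a y)) :=
        (((continuous_heatK d t x).inv₀ fun y =>
          (heatK_pos d ht x y).ne').aestronglyMeasurable).smul h.aestronglyMeasurable
      refine h2.congr (ae_of_all _ fun y => ?_)
      exact inv_smul_smul₀ (heatK_pos d ht x y).ne' (a y)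

/-- Integral bound for the truncated heat maximal function, from pointwise bounds at the
times `s²` with `0 < s ≤ τ`. -/
lemma lintegral_heat_maximal_le (d : ℕ) {K R τ : ℝ} (hK : 0 ≤ K) (hR : 0 < R) (hτ : 0 < τ)
    (w : Rd d) (a : Rd d → ℂ) (near : ∀ y, ‖a y‖ ≤ K / R ^ d)
    (far : ∀ s, 0 < s → s ≤ τ → ∀ x, 2 * R ≤ dist x w →
      ‖∫ y, heatK d (s ^ 2) x y • a y‖ ≤ K * R / dist x w ^ (d + 1)) :
    (∫⁻ x, ⨆ (t : ℝ) (_ : 0 < t) (_ : t ≤ τ ^ 2),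
        ENNReal.ofReal ‖∫ y, heatK d t x y • a y‖) ≤ ENNReal.ofReal
      (K * 3 ^ (d + 1) * ∫ x : Rd d, (1 + ‖x‖) ^ (-((d + 1 : ℕ) : ℝ))) := by
  refine lintegral_le_of_near_far d hK hR w _ (fun x => ?_) fun x hx => ?_
  · exact iSup_le fun t => iSup₂_le fun ht _ =>
      ENNReal.ofReal_le_ofReal (norm_integral_heatK_smul_le ht x near)
  · refine iSup_le fun t => iSup₂_le fun ht htτ => ENNReal.ofReal_le_ofReal ?_
    have := far (√t) (Real.sqrt_pos.2 ht) (Real.sqrt_le_iff.2 ⟨hτ.le, htτ⟩) x hx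
    rwa [Real.sq_sqrt ht.le] at this

/-- For fixed `d` and `c ≥ 1` there is a constant `C` such that, for every
`τ > 0`: (1) the heat maximal function truncated to `0 < t ≤ τ²` of every classical atom on
`ℝ^d` has `L¹`-norm at most `C`; and (2) the same holds for `a = |Q|⁻¹ χ_Q' whenever `Q` is a
cuboid whose half-sides all lie in `[τ/c, cτ]`. -/
theorem stmt5 (d : ℕ) (c : ℝ) (hc : 1 ≤ c) :
    ∃ C > 0, ∀ τ > (0 : ℝ),
      -- (1) classical atoms
      (∀ (a : Rd d → ℂ) (w : Rd d) (ρ : ℝ), 0 < ρ →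
        (∀ x ∉ cuboid univ w fun _ => ρ, a x = 0) →
        (∀ x, ‖a x‖ ≤ ((volume (cuboid univ w fun _ => ρ)).toReal)⁻¹) →
        (∫ x, a x) = 0 →
        (∫⁻ x, ⨆ (t : ℝ) (_ : 0 < t) (_ : t ≤ τ ^ 2),
            ENNReal.ofReal ‖∫ y, heatK d t x y • a y‖)
          ≤ ENNReal.ofReal C) ∧
      -- (2) local atoms |Q|⁻¹ χ_Q at scale τ
      (∀ (z : Rd d) (r : Fin d → ℝ), (∀ i, τ / c ≤ r i ∧ r i ≤ c * τ) →
        (∫⁻ x, ⨆ (t : ℝ) (_ : 0 < t) (_ : t ≤ τ ^ 2),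
            ENNReal.ofReal ‖∫ y, heatK d t x y •
              (cuboid univ z r).indicator
                (fun _ => (((volume (cuboid univ z r)).toReal)⁻¹ : ℂ)) y‖)
          ≤ ENNReal.ofReal C) := by
  set K : ℝ := (c ^ 2 * (d + 1)) ^ d + gaussMomentBound (d + 1) + gaussMomentBound (d + 2)
  have hG1 := gaussMomentBound_pos (d + 1)
  have hG2 := gaussMomentBound_pos (d + 2)
  have hc0 : 0 < c := by linarith
  have hpow : 0 < (c ^ 2 * ((d : ℝ) + 1)) ^ d := by positivity
  have hK : 0 ≤ K := by positivity
  have hI : 0 ≤ ∫ x : Rd d, (1 + ‖x‖) ^ (-((d + 1 : ℕ) : ℝ)) :=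
    integral_nonneg fun x => by positivity
  refine ⟨K * 3 ^ (d + 1) * (∫ x : Rd d, (1 + ‖x‖) ^ (-((d + 1 : ℕ) : ℝ))) + 1, by positivity,
    fun τ hτ => ⟨fun a w ρ hρ hsupp hbd h0 => ?_, fun z r hr => ?_⟩⟩
  · set Q := cuboid univ w fun _ => ρ
    have hvol := inv_toReal_volume_cuboid_le w (r := fun _ => ρ) hρ fun _ => le_rfl
    have hnear (y : Rd d) : ‖a y‖ ≤ K / ((d + 1) * ρ) ^ d := by
      refine (hbd y).trans (hvol.trans ?_)
      rw [div_le_div_iff₀ (by positivity) (by positivity), one_mul, mul_pow]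
      gcongr
      calc ((d : ℝ) + 1) ^ d ≤ (c ^ 2 * (d + 1)) ^ d := by
            gcongr
            have : 1 ≤ c ^ 2 := one_le_pow₀ hc
            exact le_mul_of_one_le_left (by positivity) this
        _ ≤ K := by linarith
    have hdom (y : Rd d) : ‖a y‖ ≤ Q.indicator (fun _ => (volume Q).toReal⁻¹) y := by
      by_cases hy : y ∈ Q
      · rw [indicator_of_mem hy]; exact hbd y
      · rw [indicator_of_notMem hy, hsupp y hy, norm_zero]
    have hg := integrable_indicator_cuboid w (fun _ => ρ) (volume Q).toReal⁻¹
    refine (lintegral_heat_maximal_le d hK (R := (d + 1) * ρ) (by positivity) hτ w a hnear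
      fun s hs _ x hx => ?_).trans (ENNReal.ofReal_le_ofReal (by linarith))
    refine (norm_integral_heatK_smul_le_of_integral_eq_zero (by positivity) x hnear h0
      (fun hm => hg.mono' hm (ae_of_all _ hdom)) (heatK d (s ^ 2) x w)).trans ?_
    refine norm_integral_smul_le_of_norm_le (fun _ => hρ) hdom fun y hy => ?_
    refine (abs_heatK_sub_heatK_le_of_far d hs (by positivity)
      (dist_le_of_mem_cuboid hρ.le (fun _ => le_rfl) hy) hx).trans ?_
    gcongr
    linarith
  · have hl : 0 < τ / c := by positivity
    have hvol := inv_toReal_volume_cuboid_le z hl fun i => (hr i).1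
    set Q := cuboid univ z r
    have hnorm (y : Rd d) : ‖Q.indicator (fun _ => (((volume Q).toReal)⁻¹ : ℂ)) y‖ =
        Q.indicator (fun _ => (volume Q).toReal⁻¹) y := by
      rw [norm_indicator_eq_indicator_norm]
      simp
    refine (lintegral_heat_maximal_le d hK (R := (d + 1) * (c * τ)) (by positivity) hτ z _
      (fun y => ?_) fun s hs hsτ x hx => ?_).trans (ENNReal.ofReal_le_ofReal (by linarith))
    · rw [hnorm]
      refine (indicator_le_self' (fun _ _ => by positivity) y).trans (hvol.trans ?_)
      rw [div_le_div_iff₀ (by positivity) (by positivity), one_mul]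
      calc (((d : ℝ) + 1) * (c * τ)) ^ d = (c ^ 2 * (d + 1)) ^ d * (τ / c) ^ d := by
            rw [← mul_pow]; congr 1; field_simp
        _ ≤ K * (τ / c) ^ d := by gcongr; linarith
    · refine norm_integral_smul_le_of_norm_le (fun i => hl.trans_le (hr i).1)
        (fun y => (hnorm y).le) fun y hy => ?_
      rw [abs_of_pos (heatK_pos d (by positivity) x y)]
      refine (heatK_le_of_far d hs (by positivity)
        (dist_le_of_mem_cuboid (by positivity) (fun i => (hr i).2) hy) hx).trans ?_
      have hsR : s ≤ (d + 1) * (c * τ) := by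
        have h1 : τ ≤ c * τ := le_mul_of_one_le_left hτ.le hc
        have h2 : c * τ ≤ (d + 1) * (c * τ) :=
          le_mul_of_one_le_left (by positivity) (by simp)
        linarith
      gcongr
      linarith
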